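/- arXiv:2208.11775 — 2 statements merged into one kernel-verified Lean document; each statement's English description precedes it below -/
import Mathlib

section
/- Let ε = {ε_Q}_{Q∈𝒟} be a collection of positive real numbers indexed by the dyadic cubes of ℝⁿ, bounded above and with the domination property, and let p be an exponent function on ℝⁿ with 1 < p_- ≤ p_+ < ∞ satisfying p ∈ LH_∞(ℝⁿ) ∩ εLH_0(ℝⁿ). Then the ε-maximal operator M_ε is bounded on L^{p(·)}(ℝⁿ): there exists a constant C = C(n, p(·), ε) such that ‖M_ε f‖_{p(·)} ≤ C‖f‖_{p(·)} for all f ∈ L^{p(·)}(ℝⁿ). -/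
open MeasureTheory Set ENNReal

noncomputable section

/-- The dyadic cube in `ℝⁿ` with side length `2^(-k)` and lower-left corner `2^(-k) • m`. -/
def dyadicCube (n : ℕ) (k : ℤ) (m : Fin n → ℤ) : Set (Fin n → ℝ) :=
  {x | ∀ i, (2 : ℝ) ^ (-k) * m i ≤ x i ∧ x i < (2 : ℝ) ^ (-k) * (m i + 1)}

/-- `Q` is a dyadic cube in `ℝⁿ`. -/
def IsDyadicCube (n : ℕ) (Q : Set (Fin n → ℝ)) : Prop :=
  ∃ (k : ℤ) (m : Fin n → ℤ), Q = dyadicCube n k m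

/-- `ε_Q` times the average of `|f|` over `Q`. -/
def epsAvg (n : ℕ) (ε : Set (Fin n → ℝ) → ℝ) (f : (Fin n → ℝ) → ℝ)
    (Q : Set (Fin n → ℝ)) : ℝ :=
  ε Q * (((volume Q).toReal)⁻¹ * ∫ y in Q, |f y| ∂volume)

/-- The ε-maximal operator `M_ε f (x) = sup_{Q ∈ 𝒟, x ∈ Q} ε_Q ⨍_Q |f|`. -/
def epsMax (n : ℕ) (ε : Set (Fin n → ℝ) → ℝ) (f : (Fin n → ℝ) → ℝ)
    (x : Fin n → ℝ) : ℝ :=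
  sSup {r : ℝ | ∃ Q, IsDyadicCube n Q ∧ x ∈ Q ∧ r = epsAvg n ε f Q}

/-- The variable Lebesgue norm `‖f‖_{p(·)}` (valued in `ℝ≥0∞`; it is `∞` iff
`f ∉ L^{p(·)}`). -/
def varLpNorm {α : Type*} [MeasurableSpace α] (p : α → ℝ) (μ : Measure α)
    (f : α → ℝ) : ℝ≥0∞ :=
  sInf {l : ℝ≥0∞ | ∃ r : ℝ, 0 < r ∧ l = ENNReal.ofReal r ∧
    ∫⁻ x, ENNReal.ofReal ((|f x| / r) ^ p x) ∂μ ≤ 1}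

/-- Membership in the variable Lebesgue space `L^{p(·)}`. -/
def MemVarLp {α : Type*} [MeasurableSpace α] (p : α → ℝ) (μ : Measure α)
    (f : α → ℝ) : Prop :=
  varLpNorm p μ f < ⊤

section NestedPartitions

variable {X I : Type*} [MeasurableSpace X] {μ : Measure X}

/-- The average of `g` over the cell of the partition `{c⁻¹{i}}` that contains `x`. -/
def cellAvg (μ : Measure X) (c : X → I) (g : X → ℝ≥0∞) (x : X) : ℝ≥0∞ :=
  (μ (c ⁻¹' {c x}))⁻¹ * ∫⁻ y in c ⁻¹' {c x}, g y ∂μ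

theorem cellAvg_mono (c : X → I) {g h : X → ℝ≥0∞} (hgh : ∀ x, g x ≤ h x) (x : X) :
    cellAvg μ c g x ≤ cellAvg μ c h x := by
  unfold cellAvg
  gcongr
  exact hgh _

theorem cellAvg_const_le (c : X → I) (t : ℝ≥0∞) (x : X) :
    cellAvg μ c (fun _ => t) x ≤ t := by
  unfold cellAvg
  rw [setLIntegral_const, mul_comm t, ← mul_assoc]
  exact mul_le_of_le_one_left' (ENNReal.inv_mul_le_one _)

theorem cellAvg_add (c : X → I) {g : X → ℝ≥0∞} (hg : Measurable g) (h : X → ℝ≥0∞) (x : X) :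
    cellAvg μ c (fun y => g y + h y) x = cellAvg μ c g x + cellAvg μ c h x := by
  unfold cellAvg
  rw [lintegral_add_left hg, mul_add]

theorem cellAvg_congr_cell {c : X → I} {x y : X} (h : c x = c y) (g : X → ℝ≥0∞) :
    cellAvg μ c g x = cellAvg μ c g y := by
  unfold cellAvg
  rw [h]

variable [MeasurableSpace I] [Countable I] [MeasurableSingletonClass I]

theorem measurable_cellAvg {c : X → I} (hc : Measurable c) (g : X → ℝ≥0∞) :
    Measurable (cellAvg μ c g) :=
  (Measurable.of_discrete (f := fun i : I => (μ (c ⁻¹' {i}))⁻¹ * ∫⁻ y in c ⁻¹' {i}, g y ∂μ)).comp hc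

theorem mul_measure_preimage_le_setLIntegral {c : X → I} (hc : Measurable c) (g : X → ℝ≥0∞)
    (t : ℝ≥0∞) (S : Set I) (hS : ∀ x, c x ∈ S → t ≤ cellAvg μ c g x) :
    t * μ (c ⁻¹' S) ≤ ∫⁻ x in c ⁻¹' S, g x ∂μ := by
  have hU : c ⁻¹' S = ⋃ i : S, c ⁻¹' {(i : I)} := by
    ext x
    simp
  have hm : ∀ i : S, MeasurableSet (c ⁻¹' {(i : I)}) := fun i => hc (measurableSet_singleton _)
  have hd : Pairwise (Function.onFun Disjoint fun i : S => c ⁻¹' {(i : I)}) := by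
    intro i j hij
    refine Disjoint.preimage _ ?_
    simpa [Subtype.ext_iff] using hij
  rw [hU, measure_iUnion hd hm, lintegral_iUnion hm hd, ← ENNReal.tsum_mul_left]
  refine ENNReal.tsum_le_tsum fun i => ?_
  rcases (c ⁻¹' {(i : I)}).eq_empty_or_nonempty with h | ⟨x, hx⟩
  · simp [h]
  · have hx' : c x = i := hx
    have := hS x (hx' ▸ i.2)
    unfold cellAvg at this
    rw [hx'] at this
    calc t * μ (c ⁻¹' {(i : I)})
        ≤ ((μ (c ⁻¹' {(i : I)}))⁻¹ * ∫⁻ y in c ⁻¹' {(i : I)}, g y ∂μ) * μ (c ⁻¹' {(i : I)}) := by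
          gcongr
      _ = (μ (c ⁻¹' {(i : I)}) * (μ (c ⁻¹' {(i : I)}))⁻¹) * ∫⁻ y in c ⁻¹' {(i : I)}, g y ∂μ := by
          ring
      _ ≤ _ := mul_le_of_le_one_left' (ENNReal.mul_inv_le_one _)

theorem weak_type_nested {c : ℕ → X → I} (hc : ∀ j, Measurable (c j))
    (hnest : ∀ i j, i ≤ j → ∀ x y, c j x = c j y → c i x = c i y) (g : X → ℝ≥0∞) (t : ℝ≥0∞) :
    t * μ {x | ∃ j, t < cellAvg μ (c j) g x} ≤ ∫⁻ x, g x ∂μ := by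
  set D : ℕ → Set X := fun j =>
    {x | t < cellAvg μ (c j) g x ∧ ∀ i < j, ¬ t < cellAvg μ (c i) g x} with hD
  have hsat : ∀ j, c j ⁻¹' (c j '' D j) = D j := by
    intro j
    refine subset_antisymm ?_ (subset_preimage_image _ _)
    rintro x ⟨y, ⟨hy1, hy2⟩, hyx⟩
    refine ⟨cellAvg_congr_cell (μ := μ) hyx g ▸ hy1, fun i hi => ?_⟩
    rw [← cellAvg_congr_cell (μ := μ) (hnest i j hi.le _ _ hyx) g]
    exact hy2 i hi
  have hU : {x | ∃ j, t < cellAvg μ (c j) g x} = ⋃ j, D j := by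
    ext x
    simp only [mem_ofPred_eq, mem_iUnion, hD]
    classical
    exact ⟨fun h => ⟨Nat.find h, Nat.find_spec h, fun i hi => Nat.find_min h hi⟩,
      fun ⟨j, hj, _⟩ => ⟨j, hj⟩⟩
  have hm : ∀ j, MeasurableSet (D j) := fun j => by
    rw [← hsat j]
    exact hc j (Set.to_countable _).measurableSet
  have hd : Pairwise (Function.onFun Disjoint D) := by
    intro i j hij
    refine Set.disjoint_left.2 fun x hi hj => ?_
    rcases hij.lt_or_gt with h | h
    · exact hj.2 i h hi.1
    · exact hi.2 j h hj.1
  calc t * μ {x | ∃ j, t < cellAvg μ (c j) g x}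
      = ∑' j, t * μ (D j) := by rw [hU, measure_iUnion hd hm, ENNReal.tsum_mul_left]
    _ ≤ ∑' j, ∫⁻ x in D j, g x ∂μ := by
        refine ENNReal.tsum_le_tsum fun j => ?_
        rw [← hsat j]
        refine mul_measure_preimage_le_setLIntegral (hc j) g t _ ?_
        rintro x ⟨y, hy, hyx⟩
        rw [← cellAvg_congr_cell (μ := μ) hyx g]
        exact hy.1.le
    _ = ∫⁻ x in ⋃ j, D j, g x ∂μ := (lintegral_iUnion hm hd _).symm
    _ ≤ ∫⁻ x, g x ∂μ := setLIntegral_le_lintegral _ _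

theorem weak_type_nested_truncated {c : ℕ → X → I} (hc : ∀ j, Measurable (c j))
    (hnest : ∀ i j, i ≤ j → ∀ x y, c j x = c j y → c i x = c i y) {g : X → ℝ≥0∞}
    (hg : Measurable g) {t : ℝ≥0∞} (ht : t ≠ ∞) :
    t * μ {x | ∃ j, 2 * t < cellAvg μ (c j) g x} ≤ ∫⁻ x in {x | t < g x}, g x ∂μ := by
  have hms : MeasurableSet {x | t < g x} := measurableSet_lt measurable_const hg
  rw [← lintegral_indicator hms]
  refine le_trans ?_ (weak_type_nested (μ := μ) hc hnest _ t)
  gcongr t * μ ?_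
  rintro x ⟨j, hj⟩
  refine ⟨j, ?_⟩
  have h1 : cellAvg μ (c j) g x ≤ cellAvg μ (c j) ({x | t < g x}.indicator g) x + t := by
    refine le_trans ?_ (add_le_add le_rfl (cellAvg_const_le (μ := μ) (c j) t x))
    rw [← cellAvg_add _ (hg.indicator hms)]
    refine cellAvg_mono _ (fun y => ?_) x
    by_cases hy : t < g y
    · rw [indicator_of_mem (by exact hy)]
      exact le_self_add
    · rw [indicator_of_notMem (by exact hy), zero_add]
      exact not_lt.1 hy
  rw [two_mul] at hj
  exact (ENNReal.add_lt_add_iff_right ht).1 (hj.trans_le h1)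

theorem lintegral_rpow_le_of_weak_type {g h : X → ℝ} (hg0 : ∀ x, 0 ≤ g x) (hg : Measurable g)
    (hh0 : ∀ x, 0 ≤ h x) (hh : Measurable h)
    (hw : ∀ t : ℝ, 0 < t → ENNReal.ofReal t * μ {x | t < h x} ≤
      ∫⁻ x in {x | t < g x}, ENNReal.ofReal (g x) ∂μ) {s : ℝ} (hs : 1 < s) :
    ∫⁻ x, ENNReal.ofReal (h x ^ s) ∂μ ≤
      ENNReal.ofReal (s / (s - 1)) * ∫⁻ x, ENNReal.ofReal (g x ^ s) ∂μ := by
  have hs1 : 0 < s - 1 := by linarith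
  have hG : Measurable fun x => ENNReal.ofReal (g x) := hg.ennreal_ofReal
  set ν := μ.withDensity fun x => ENNReal.ofReal (g x) with hν
  have hν_int : ∫⁻ x, ENNReal.ofReal (g x ^ (s - 1)) ∂ν = ∫⁻ x, ENNReal.ofReal (g x ^ s) ∂μ := by
    rw [hν, lintegral_withDensity_eq_lintegral_mul _ hG (by fun_prop)]
    refine lintegral_congr fun x => ?_
    rw [Pi.mul_apply, ← ENNReal.ofReal_mul (hg0 x)]
    congr 1
    rcases (hg0 x).eq_or_lt with h0 | h0
    · rw [← h0, zero_mul, Real.zero_rpow (by linarith)]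
    · rw [Real.rpow_sub_one h0.ne']
      field_simp
  have hlayer := lintegral_rpow_eq_lintegral_meas_lt_mul ν (Filter.Eventually.of_forall hg0)
    hg.aemeasurable hs1
  rw [lintegral_rpow_eq_lintegral_meas_lt_mul μ (Filter.Eventually.of_forall hh0)
    hh.aemeasurable (by linarith : 0 < s), ← hν_int, hlayer, ← mul_assoc,
    ← ENNReal.ofReal_mul (by positivity), div_mul_cancel₀ _ hs1.ne']
  gcongr ENNReal.ofReal s * ?_
  refine setLIntegral_mono' measurableSet_Ioi fun t ht => ?_
  have ht : 0 < t := ht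
  rw [hν, withDensity_apply _ (measurableSet_lt measurable_const hg)]
  refine le_trans ?_ (mul_le_mul_left (hw t ht) _)
  rw [mul_right_comm, ← ENNReal.ofReal_mul ht.le, mul_comm]
  gcongr
  rw [Real.rpow_sub_one ht.ne' (s - 1)]
  field_simp
  exact le_rfl

/-- The maximal function attached to a chain of partitions is bounded on `L^s` for `s > 1`. -/
theorem lintegral_iSup_cellAvg_rpow_le {c : ℤ → X → I} (hc : ∀ k, Measurable (c k))
    (hnest : ∀ i j, i ≤ j → ∀ x y, c j x = c j y → c i x = c i y) {g : X → ℝ}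
    (hg0 : ∀ x, 0 ≤ g x) (hg : Measurable g) {s : ℝ} (hs : 1 < s) :
    ∫⁻ x, (⨆ k, cellAvg μ (c k) (fun y => ENNReal.ofReal (g y)) x) ^ s ∂μ ≤
      ENNReal.ofReal (2 ^ s * (s / (s - 1))) * ∫⁻ x, ENNReal.ofReal (g x) ^ s ∂μ := by
  have hs0 : 0 < s := by linarith
  set G : X → ℝ≥0∞ := fun y => ENNReal.ofReal (g y)
  have hG : Measurable G := hg.ennreal_ofReal
  set H : ℕ → X → ℝ≥0∞ := fun N x => min (⨆ j : ℕ, cellAvg μ (c (j - N)) G x) N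
  have hHm : ∀ N, Measurable (H N) := fun N =>
    (Measurable.iSup fun j => measurable_cellAvg (hc _) G).min measurable_const
  have hHfin : ∀ N x, H N x ≠ ∞ := fun N x =>
    ne_top_of_le_ne_top (ENNReal.natCast_ne_top N) (min_le_right _ _)
  have hmono : Monotone H := by
    intro N N' hN x
    refine min_le_min (iSup_le fun j => ?_) (by exact_mod_cast hN)
    refine le_trans (le_of_eq ?_) (le_iSup _ (j + (N' - N)))
    congr 2
    push_cast [Nat.cast_sub hN]
    ring
  have hsup : ∀ x, (⨆ k, cellAvg μ (c k) G x) = ⨆ N, H N x := by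
    intro x
    refine le_antisymm (iSup_le fun k => ?_) (iSup_le fun N => (min_le_left _ _).trans
      (iSup_le fun j => le_iSup (fun k => cellAvg μ (c k) G x) _))
    refine le_of_forall_lt fun a ha => ?_
    obtain ⟨N₀, hN₀⟩ := ENNReal.exists_nat_gt ha.ne_top
    have hN : (k.natAbs : ℤ) ≤ ((max N₀ k.natAbs : ℕ) : ℤ) := by
      exact_mod_cast le_max_right _ _
    refine lt_of_lt_of_le ?_ (le_iSup (fun N => H N x) (max N₀ k.natAbs))
    refine lt_min (ha.trans_le ?_) (hN₀.trans_le (by exact_mod_cast le_max_left _ _))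
    refine le_trans (le_of_eq ?_) (le_iSup _ (k + (max N₀ k.natAbs : ℕ)).toNat)
    congr 2
    omega
  have hN : ∀ N, ∫⁻ x, H N x ^ s ∂μ ≤
      ENNReal.ofReal (2 ^ s * (s / (s - 1))) * ∫⁻ x, ENNReal.ofReal (g x) ^ s ∂μ := by
    intro N
    have key := lintegral_rpow_le_of_weak_type (μ := μ) (g := g)
      (h := fun x => (H N x).toReal / 2) hg0 hg (fun x => by positivity)
      ((hHm N).ennreal_toReal.div_const 2) (fun t ht => by
        have := weak_type_nested_truncated (μ := μ) (c := fun j : ℕ => c (j - N))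
          (fun j => hc _) (fun i j hij => hnest _ _ (by omega)) hG
          (ENNReal.ofReal_ne_top (r := t))
        have hset : {x | ENNReal.ofReal t < G x} = {x | t < g x} := by
          ext x
          exact ENNReal.ofReal_lt_ofReal_iff_of_nonneg ht.le
        rw [hset] at this
        refine le_trans ?_ this
        gcongr with x
        intro (hx : t < (H N x).toReal / 2)
        have h2 : 2 * ENNReal.ofReal t < H N x := by
          rw [← ENNReal.ofReal_toReal (hHfin N x)]
          have : (2 : ℝ≥0∞) = ENNReal.ofReal 2 := by simp
          rw [this, ← ENNReal.ofReal_mul (by norm_num), ENNReal.ofReal_lt_ofReal_iff (by linarith)]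
          linarith
        exact lt_iSup_iff.1 (h2.trans_le (min_le_left _ _))) hs
    calc ∫⁻ x, H N x ^ s ∂μ
        = ∫⁻ x, ENNReal.ofReal (2 ^ s) * ENNReal.ofReal (((H N x).toReal / 2) ^ s) ∂μ := by
          refine lintegral_congr fun x => ?_
          rw [← ENNReal.ofReal_mul (by positivity), ← Real.mul_rpow (by norm_num) (by positivity),
            mul_div_cancel₀ _ (by norm_num), ← ENNReal.ofReal_rpow_of_nonneg (by positivity) hs0.le,
            ENNReal.ofReal_toReal (hHfin N x)]
      _ = ENNReal.ofReal (2 ^ s) * ∫⁻ x, ENNReal.ofReal (((H N x).toReal / 2) ^ s) ∂μ :=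
          lintegral_const_mul' _ _ ENNReal.ofReal_ne_top
      _ ≤ ENNReal.ofReal (2 ^ s) *
            (ENNReal.ofReal (s / (s - 1)) * ∫⁻ x, ENNReal.ofReal (g x ^ s) ∂μ) := by gcongr
      _ = _ := by
          rw [← mul_assoc, ← ENNReal.ofReal_mul (by positivity)]
          simp_rw [ENNReal.ofReal_rpow_of_nonneg (hg0 _) hs0.le]
  calc ∫⁻ x, (⨆ k, cellAvg μ (c k) G x) ^ s ∂μ
      = ∫⁻ x, ⨆ N, H N x ^ s ∂μ := by
        refine lintegral_congr fun x => ?_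
        rw [hsup]
        exact (ENNReal.orderIsoRpow s hs0).map_iSup _
    _ = ⨆ N, ∫⁻ x, H N x ^ s ∂μ :=
        lintegral_iSup (fun N => (hHm N).pow_const s) fun N N' h x =>
          ENNReal.rpow_le_rpow (hmono h x) hs0.le
    _ ≤ _ := iSup_le hN

end NestedPartitions

section LocalEstimate

theorem div_rpow_le_max_of_rpow_neg_le {e e' w δ d C : ℝ} (he : 0 < e) (hee : e ≤ e') (hw : 0 < w)
    (hδ : 0 ≤ δ) (hδd : δ ≤ d) (hC : (w / e') ^ (-d) ≤ C) : (e / w) ^ δ ≤ max 1 C := by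
  rcases le_total (e / w) 1 with h | h
  · exact (Real.rpow_le_one (by positivity) h hδ).trans (le_max_left _ _)
  · refine le_trans ?_ (le_max_right _ _)
    refine le_trans ?_ hC
    have he' : 0 < e' := he.trans_le hee
    rw [Real.rpow_neg (by positivity), ← Real.inv_rpow (by positivity), inv_div]
    calc (e / w) ^ δ ≤ (e / w) ^ d := Real.rpow_le_rpow_of_exponent_le h hδd
      _ ≤ (e' / w) ^ d := by gcongr; exact hδ.trans hδd

variable {X : Type*} [MeasurableSpace X] {μ : Measure X}

theorem setAverage_le_rpow_setAverage_rpow {Q : Set X} (hQ0 : μ Q ≠ 0) (hQ : μ Q ≠ ∞) {r : ℝ}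
    (hr : 1 ≤ r) {U : X → ℝ≥0∞} (hU : Measurable U) :
    (μ Q)⁻¹ * ∫⁻ y in Q, U y ∂μ ≤ ((μ Q)⁻¹ * ∫⁻ y in Q, U y ^ r ∂μ) ^ (1 / r) := by
  have : IsProbabilityMeasure ((μ Q)⁻¹ • μ.restrict Q) :=
    ⟨by simp [ENNReal.inv_mul_cancel hQ0 hQ]⟩
  have h := eLpNorm'_le_eLpNorm'_of_exponent_le one_pos hr ((μ Q)⁻¹ • μ.restrict Q)
    hU.aestronglyMeasurable
  simpa [eLpNorm'_eq_lintegral_enorm, lintegral_smul_measure] using h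

/-- The local part of the pointwise estimate: on the part where `|f| ≥ 1`. -/
theorem weighted_setAverage_rpow_le {Q : Set X} (hQ0 : μ Q ≠ 0) (hQ : μ Q ≠ ∞)
    {p u : X → ℝ} (hu : Measurable u) (hu1 : ∀ y, u y = 0 ∨ 1 ≤ u y)
    {s pm pM a e e' C : ℝ} (hs : 1 ≤ s) (hspm : s ≤ pm) (hp : ∀ᵐ y ∂μ.restrict Q, pm ≤ p y)
    (ha : pm ≤ a) (haM : a ≤ pM) (he : 0 < e) (he1 : e ≤ 1) (hee : e ≤ e')
    (hC : ((μ Q).toReal / e') ^ (pm - pM) ≤ C)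
    (hint : ∫⁻ y, ENNReal.ofReal (u y ^ p y) ∂μ ≤ 1) :
    (ENNReal.ofReal e * ((μ Q)⁻¹ * ∫⁻ y in Q, ENNReal.ofReal (u y) ∂μ)) ^ a ≤
      ENNReal.ofReal (max 1 C) ^ s *
        ((μ Q)⁻¹ * ∫⁻ y in Q, ENNReal.ofReal (u y ^ (p y / s)) ∂μ) ^ s := by
  have hs0 : 0 < s := by linarith
  have hpm0 : 0 < pm := by linarith
  have ha0 : 0 < a := by linarith
  set J := (μ Q)⁻¹ * ∫⁻ y in Q, ENNReal.ofReal (u y ^ (p y / s)) ∂μ with hJ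
  have hr : 1 ≤ pm / s := (one_le_div hs0).2 hspm
  have h1 : (μ Q)⁻¹ * ∫⁻ y in Q, ENNReal.ofReal (u y) ∂μ ≤ J ^ (1 / (pm / s)) := by
    refine (setAverage_le_rpow_setAverage_rpow hQ0 hQ hr hu.ennreal_ofReal).trans ?_
    refine ENNReal.rpow_le_rpow ?_ (by positivity)
    rw [hJ]
    gcongr 1
    refine lintegral_mono_ae ?_
    filter_upwards [hp] with y hy
    rcases hu1 y with h | h
    · rw [h, ENNReal.ofReal_zero, ENNReal.zero_rpow_of_pos (by positivity)]
      exact zero_le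
    · rw [ENNReal.ofReal_rpow_of_nonneg (by linarith) (by positivity)]
      gcongr
  have h2 : J ≤ (μ Q)⁻¹ := by
    refine mul_le_of_le_one_right' ?_
    refine le_trans ?_ ((setLIntegral_le_lintegral Q _).trans hint)
    refine lintegral_mono_ae ?_
    filter_upwards [hp] with y hy
    have hpy : 0 < p y := by linarith
    rcases hu1 y with h | h
    · rw [h, Real.zero_rpow (by positivity), Real.zero_rpow (by positivity)]
    · gcongr
      exact div_le_self hpy.le hs
  set δ := a / pm - 1 with hδ
  have hδ0 : 0 ≤ δ := by
    rw [hδ, sub_nonneg, one_le_div hpm0]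
    exact ha
  have hδd : δ ≤ pM - pm := by
    have : δ = (a - pm) / pm := by rw [hδ]; field_simp
    rw [this]
    exact (div_le_self (by linarith) (by linarith)).trans (by linarith)
  have hδa : δ ≤ a / s := by
    have : a / pm ≤ a / s := by gcongr
    linarith
  have hμ : (μ Q)⁻¹ = ENNReal.ofReal ((μ Q).toReal)⁻¹ := by
    rw [ENNReal.ofReal_inv_of_pos (ENNReal.toReal_pos hQ0 hQ), ENNReal.ofReal_toReal hQ]
  have h3 : (ENNReal.ofReal e * (μ Q)⁻¹) ^ δ ≤ ENNReal.ofReal (max 1 C) := by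
    rw [hμ, ← ENNReal.ofReal_mul he.le, ENNReal.ofReal_rpow_of_nonneg (by positivity) hδ0,
      ← div_eq_mul_inv]
    refine ENNReal.ofReal_le_ofReal (div_rpow_le_max_of_rpow_neg_le he hee
      (ENNReal.toReal_pos hQ0 hQ) hδ0 hδd ?_)
    rwa [neg_sub]
  have h4 : (ENNReal.ofReal e * ((μ Q)⁻¹ * ∫⁻ y in Q, ENNReal.ofReal (u y) ∂μ)) ^ (a / s) ≤
      ENNReal.ofReal (max 1 C) * J := by
    calc _ ≤ (ENNReal.ofReal e * J ^ (1 / (pm / s))) ^ (a / s) := by gcongr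
      _ = ENNReal.ofReal e ^ (a / s) * (J ^ δ * J) := by
          rw [ENNReal.mul_rpow_of_nonneg _ _ (by positivity), ← ENNReal.rpow_mul]
          congr 1
          conv_rhs => rw [← ENNReal.rpow_one J, ← ENNReal.rpow_mul, one_mul]
          rw [← ENNReal.rpow_add_of_nonneg _ _ hδ0 zero_le_one]
          congr 1
          rw [hδ]
          field_simp
          ring
      _ ≤ ENNReal.ofReal e ^ δ * ((μ Q)⁻¹ ^ δ * J) := by
          gcongr ?_ * (?_ ^ δ * J)
          exact ENNReal.rpow_le_rpow_of_exponent_ge (ENNReal.ofReal_le_one.2 he1) hδa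
      _ = (ENNReal.ofReal e * (μ Q)⁻¹) ^ δ * J := by
          rw [ENNReal.mul_rpow_of_nonneg _ _ hδ0, mul_assoc]
      _ ≤ _ := by gcongr
  calc _ = ((ENNReal.ofReal e * ((μ Q)⁻¹ * ∫⁻ y in Q, ENNReal.ofReal (u y) ∂μ)) ^ (a / s)) ^ s := by
        rw [← ENNReal.rpow_mul, div_mul_cancel₀ _ hs0.ne']
    _ ≤ (ENNReal.ofReal (max 1 C) * J) ^ s := by gcongr
    _ = _ := ENNReal.mul_rpow_of_nonneg _ _ hs0.le

end LocalEstimate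

section LogHolder

theorem rpow_le_exp_mul_rpow_add {y T a b C N : ℝ} (hy0 : 0 ≤ y) (hy1 : y ≤ 1)
    (hT : Real.exp 1 ≤ T) (ha : 1 ≤ a) (hN : 0 ≤ N) (hab : |a - b| ≤ C / Real.log T) :
    y ^ a ≤ Real.exp (C * N) * y ^ b + T ^ (-N) := by
  have hT0 : 0 < T := (Real.exp_pos 1).trans_le hT
  have hT1 : 1 ≤ T := (Real.one_le_exp zero_le_one).trans hT
  have hlog : 0 < Real.log T := by
    rw [← Real.log_exp 1] at *
    exact lt_of_lt_of_le (by simp) (Real.log_le_log (Real.exp_pos _) hT)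
  have hR1 : T ^ (-N) ≤ 1 := Real.rpow_le_one_of_one_le_of_nonpos hT1 (by linarith)
  rcases le_total y (T ^ (-N)) with h | h
  · have h1 : y ^ a ≤ y := by
      simpa using Real.rpow_le_rpow_of_exponent_ge_of_imp hy0 hy1 ha (by intros; linarith)
    have : 0 ≤ Real.exp (C * N) * y ^ b := by positivity
    linarith
  · have hy : 0 < y := lt_of_lt_of_le (by positivity) h
    have h1 : y ^ a ≤ Real.exp (C * N) * y ^ b := by
      have h2 : y ^ (a - b) ≤ Real.exp (C * N) := by
        calc y ^ (a - b) ≤ y ^ (-|a - b|) :=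
              Real.rpow_le_rpow_of_exponent_ge hy hy1 (neg_abs_le _)
          _ ≤ (T ^ (-N)) ^ (-|a - b|) :=
              Real.rpow_le_rpow_of_nonpos (by positivity) h (by simp)
          _ = T ^ (N * |a - b|) := by
              rw [← Real.rpow_mul hT0.le]
              congr 1
              ring
          _ ≤ T ^ (N * (C / Real.log T)) := by gcongr
          _ = Real.exp (C * N) := by
              rw [Real.rpow_def_of_pos hT0]
              congr 1
              field_simp
      calc y ^ a = y ^ (a - b) * y ^ b := by
            rw [← Real.rpow_add hy, sub_add_cancel]
        _ ≤ _ := by gcongr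
    have : 0 ≤ T ^ (-N) := by positivity
    linarith

theorem ennreal_rpow_le_exp_mul_rpow_add {y : ℝ≥0∞} {T a b C N : ℝ} (hy1 : y ≤ 1)
    (hT : Real.exp 1 ≤ T) (ha : 1 ≤ a) (hb : 0 ≤ b) (hN : 0 ≤ N)
    (hab : |a - b| ≤ C / Real.log T) :
    y ^ a ≤ ENNReal.ofReal (Real.exp (C * N)) * y ^ b + ENNReal.ofReal (T ^ (-N)) := by
  have hT0 : 0 < T := (Real.exp_pos 1).trans_le hT
  have hy : y ≠ ∞ := ne_top_of_le_ne_top one_ne_top hy1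
  rw [← ENNReal.ofReal_toReal hy, ENNReal.ofReal_rpow_of_nonneg (by positivity) (by linarith),
    ENNReal.ofReal_rpow_of_nonneg (by positivity) hb, ← ENNReal.ofReal_mul (by positivity),
    ← ENNReal.ofReal_add (by positivity) (by positivity)]
  exact ENNReal.ofReal_le_ofReal (rpow_le_exp_mul_rpow_add (by positivity)
    (ENNReal.toReal_mono one_ne_top hy1) hT ha hN hab)

end LogHolder

section DyadicCubes

variable {n : ℕ}

/-- The index of the dyadic cube of side length `2^(-k)` that contains `x`. -/
def dyadicIndex (n : ℕ) (k : ℤ) (x : Fin n → ℝ) : Fin n → ℤ := fun i => ⌊(2 : ℝ) ^ k * x i⌋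

theorem measurable_dyadicIndex (k : ℤ) : Measurable (dyadicIndex n k) :=
  measurable_pi_lambda _ fun i => Int.measurable_floor.comp ((measurable_pi_apply i).const_mul _)

theorem dyadicCube_eq_preimage (k : ℤ) (m : Fin n → ℤ) :
    dyadicCube n k m = dyadicIndex n k ⁻¹' {m} := by
  ext x
  have h2 : (0 : ℝ) < 2 ^ k := by positivity
  simp [dyadicCube, dyadicIndex, funext_iff, Int.floor_eq_iff, inv_mul_le_iff₀ h2,
    lt_inv_mul_iff₀ h2]

theorem dyadicIndex_nested (i j : ℤ) (hij : i ≤ j) (x y : Fin n → ℝ)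
    (h : dyadicIndex n j x = dyadicIndex n j y) : dyadicIndex n i x = dyadicIndex n i y := by
  obtain ⟨d, rfl⟩ := Int.le.dest hij
  have key : ∀ t : ℝ, ⌊(2 : ℝ) ^ i * t⌋ = ⌊(2 : ℝ) ^ (i + (d : ℤ)) * t⌋ / ((2 ^ d : ℕ) : ℤ) := by
    intro t
    rw [← Int.floor_div_natCast]
    congr 1
    rw [zpow_add₀ two_ne_zero, zpow_natCast]
    push_cast
    field_simp
  ext l
  have hl := congrFun h l
  simp only [dyadicIndex] at hl ⊢
  rw [key, key, hl]

theorem volume_dyadicCube (k : ℤ) (m : Fin n → ℤ) :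
    volume (dyadicCube n k m) = ENNReal.ofReal (2 ^ (-k)) ^ n := by
  have : dyadicCube n k m =
      pi univ fun i => Ico ((2 : ℝ) ^ (-k) * m i) ((2 : ℝ) ^ (-k) * (m i + 1)) := by
    ext x
    simp [dyadicCube]
  rw [this, Real.volume_pi_Ico]
  simp [mul_add]

theorem volume_dyadicCube_ne_zero (k : ℤ) (m : Fin n → ℤ) : volume (dyadicCube n k m) ≠ 0 := by
  rw [volume_dyadicCube]
  exact pow_ne_zero _ (ENNReal.ofReal_pos.2 (by positivity)).ne'

theorem volume_dyadicCube_ne_top (k : ℤ) (m : Fin n → ℤ) : volume (dyadicCube n k m) ≠ ∞ := by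
  rw [volume_dyadicCube]
  exact ENNReal.pow_ne_top ENNReal.ofReal_ne_top

theorem cellAvg_dyadicIndex {k : ℤ} {m : Fin n → ℤ} {x : Fin n → ℝ} (hx : x ∈ dyadicCube n k m)
    (g : (Fin n → ℝ) → ℝ≥0∞) :
    cellAvg volume (dyadicIndex n k) g x =
      (volume (dyadicCube n k m))⁻¹ * ∫⁻ y in dyadicCube n k m, g y := by
  rw [dyadicCube_eq_preimage] at hx ⊢
  have : dyadicIndex n k x = m := hx
  rw [cellAvg, this]

theorem ofReal_epsAvg_le {ε : Set (Fin n → ℝ) → ℝ} {Q : Set (Fin n → ℝ)} (hε : 0 ≤ ε Q)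
    (hQ0 : volume Q ≠ 0) (hQ : volume Q ≠ ∞) (f : (Fin n → ℝ) → ℝ) :
    ENNReal.ofReal (epsAvg n ε f Q) ≤
      ENNReal.ofReal (ε Q) * ((volume Q)⁻¹ * ∫⁻ y in Q, ENNReal.ofReal |f y|) := by
  rw [epsAvg, ENNReal.ofReal_mul hε, ENNReal.ofReal_mul (by positivity),
    ENNReal.ofReal_inv_of_pos (ENNReal.toReal_pos hQ0 hQ), ENNReal.ofReal_toReal hQ]
  gcongr
  by_cases hf : Integrable (fun y => |f y|) (volume.restrict Q)
  · rw [ofReal_integral_eq_lintegral_ofReal hf (Filter.Eventually.of_forall fun _ => abs_nonneg _)]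
  · simp [integral_undef hf]

end DyadicCubes

section Modular

theorem ofReal_abs_sSup_div_rpow_le {S : Set ℝ} (hS : ∀ r ∈ S, 0 ≤ r) {c a : ℝ} (hc : 0 < c)
    (ha : 0 < a) {R : ℝ≥0∞} (h : ∀ r ∈ S, ENNReal.ofReal (r / c) ^ a ≤ R) :
    ENNReal.ofReal ((|sSup S| / c) ^ a) ≤ R := by
  rcases eq_or_ne R ∞ with rfl | hR
  · exact le_top
  have hRa : R ^ a⁻¹ ≠ ∞ := ENNReal.rpow_ne_top_of_nonneg (by positivity) hR
  have h1 : sSup S ≤ c * (R ^ a⁻¹).toReal := by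
    refine Real.sSup_le (fun r hr => ?_) (by positivity)
    rw [mul_comm, ← div_le_iff₀ hc]
    exact (ENNReal.ofReal_le_iff_le_toReal hRa).1 ((ENNReal.le_rpow_inv_iff ha).2 (h r hr))
  rw [abs_of_nonneg (Real.sSup_nonneg hS),
    ← ENNReal.ofReal_rpow_of_nonneg (div_nonneg (Real.sSup_nonneg hS) hc.le) ha.le,
    ← ENNReal.le_rpow_inv_iff ha, ENNReal.ofReal_le_iff_le_toReal hRa, div_le_iff₀ hc, mul_comm]
  exact h1

variable {n : ℕ}

theorem lintegral_ofReal_exp_one_add_norm_rpow_lt_top :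
    ∫⁻ x : Fin n → ℝ, ENNReal.ofReal ((Real.exp 1 + ‖x‖) ^ (-((n : ℝ) + 1))) < ∞ := by
  refine lt_of_le_of_lt ?_ (finite_integral_one_add_norm (E := Fin n → ℝ) (μ := volume)
    (r := (n : ℝ) + 1) (by simp))
  refine lintegral_mono fun x => ENNReal.ofReal_le_ofReal ?_
  refine Real.rpow_le_rpow_of_nonpos (by positivity) ?_ (by linarith [n.cast_nonneg (α := ℝ)])
  gcongr
  exact Real.one_le_exp zero_le_one

/-- The dyadic maximal function. -/
def dyadicMax (n : ℕ) (g : (Fin n → ℝ) → ℝ) (x : Fin n → ℝ) : ℝ≥0∞ :=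
  ⨆ k, cellAvg volume (dyadicIndex n k) (fun y => ENNReal.ofReal (g y)) x

theorem measurable_dyadicMax (g : (Fin n → ℝ) → ℝ) : Measurable (dyadicMax n g) :=
  Measurable.iSup fun k => measurable_cellAvg (measurable_dyadicIndex k) _

theorem lintegral_dyadicMax_rpow_le {g : (Fin n → ℝ) → ℝ} (hg0 : ∀ x, 0 ≤ g x)
    (hg : Measurable g) {s : ℝ} (hs : 1 < s) :
    ∫⁻ x, dyadicMax n g x ^ s ≤
      ENNReal.ofReal (2 ^ s * (s / (s - 1))) * ∫⁻ x, ENNReal.ofReal (g x) ^ s :=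
  lintegral_iSup_cellAvg_rpow_le measurable_dyadicIndex dyadicIndex_nested hg0 hg hs

theorem dyadicMax_le_one {g : (Fin n → ℝ) → ℝ} (hg : ∀ x, g x ≤ 1) (x : Fin n → ℝ) :
    dyadicMax n g x ≤ 1 :=
  iSup_le fun _ => (cellAvg_mono _ (fun y => ENNReal.ofReal_le_one.2 (hg y)) x).trans
    (cellAvg_const_le _ 1 x)

theorem setAverage_le_dyadicMax {k : ℤ} {m : Fin n → ℤ} {x : Fin n → ℝ}
    (hx : x ∈ dyadicCube n k m) (g : (Fin n → ℝ) → ℝ) :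
    (volume (dyadicCube n k m))⁻¹ * ∫⁻ y in dyadicCube n k m, ENNReal.ofReal (g y) ≤
      dyadicMax n g x := by
  rw [← cellAvg_dyadicIndex hx]
  exact le_iSup (fun k => cellAvg volume (dyadicIndex n k) (fun y => ENNReal.ofReal (g y)) x) k

/-- Modular bound for the dyadic maximal function of a function with values in `[0, 1]`, for an
exponent that satisfies the log-Hölder condition at infinity. -/
theorem lintegral_dyadicMax_rpow_le_of_le_one {p : (Fin n → ℝ) → ℝ} (hp : ∀ᵐ x, 1 ≤ p x)
    {pinf Cinf : ℝ} (hpinf : 1 < pinf)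
    (hLH : ∀ᵐ x : Fin n → ℝ, |p x - pinf| ≤ Cinf / Real.log (Real.exp 1 + ‖x‖)) :
    ∃ K : ℝ≥0∞, K ≠ ∞ ∧ ∀ g : (Fin n → ℝ) → ℝ, Measurable g → (∀ x, 0 ≤ g x) → (∀ x, g x ≤ 1) →
      ∫⁻ x, ENNReal.ofReal (g x) ^ p x ≤ 1 → ∫⁻ x, dyadicMax n g x ^ p x ≤ K := by
  set A := ENNReal.ofReal (Real.exp (Cinf * ((n : ℝ) + 1)))
  set W : (Fin n → ℝ) → ℝ≥0∞ := fun x =>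
    ENNReal.ofReal ((Real.exp 1 + ‖x‖) ^ (-((n : ℝ) + 1))) with hW
  have hWm : Measurable W := by
    rw [hW]
    fun_prop
  have hWfin : ∫⁻ x, W x ≠ ∞ := lintegral_ofReal_exp_one_add_norm_rpow_lt_top.ne
  set M := ENNReal.ofReal (2 ^ pinf * (pinf / (pinf - 1)))
  have hAfin : A ≠ ∞ := ENNReal.ofReal_ne_top
  have hMfin : M ≠ ∞ := ENNReal.ofReal_ne_top
  refine ⟨A * (M * (A + ∫⁻ x, W x)) + ∫⁻ x, W x, by finiteness, fun g hg hg0 hg1 hint => ?_⟩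
  have hT : ∀ x : Fin n → ℝ, Real.exp 1 ≤ Real.exp 1 + ‖x‖ := fun x => by simp
  have h1 : ∫⁻ x, ENNReal.ofReal (g x) ^ pinf ≤ A + ∫⁻ x, W x := by
    calc ∫⁻ x, ENNReal.ofReal (g x) ^ pinf
        ≤ ∫⁻ x, (A * ENNReal.ofReal (g x) ^ p x + W x) := by
          refine lintegral_mono_ae ?_
          filter_upwards [hp, hLH] with x hx hx'
          exact ennreal_rpow_le_exp_mul_rpow_add (ENNReal.ofReal_le_one.2 (hg1 x)) (hT x) hpinf.le
            (by linarith) (by positivity) (by rwa [abs_sub_comm])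
      _ = A * (∫⁻ x, ENNReal.ofReal (g x) ^ p x) + ∫⁻ x, W x := by
          rw [lintegral_add_right _ hWm, lintegral_const_mul' _ _ hAfin]
      _ ≤ A + ∫⁻ x, W x := by
          gcongr
          exact mul_le_of_le_one_right' hint
  calc ∫⁻ x, dyadicMax n g x ^ p x
      ≤ ∫⁻ x, (A * dyadicMax n g x ^ pinf + W x) := by
        refine lintegral_mono_ae ?_
        filter_upwards [hp, hLH] with x hx hx'
        exact ennreal_rpow_le_exp_mul_rpow_add (dyadicMax_le_one hg1 x) (hT x) hx
          (by linarith) (by positivity) hx'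
    _ = A * (∫⁻ x, dyadicMax n g x ^ pinf) + ∫⁻ x, W x := by
        rw [lintegral_add_right _ hWm, lintegral_const_mul' _ _ hAfin]
    _ ≤ _ := by
        gcongr
        exact (lintegral_dyadicMax_rpow_le hg0 hg hpinf).trans (by gcongr)

theorem ofReal_epsAvg_div_rpow_le {ε : Set (Fin n → ℝ) → ℝ} {Q : Set (Fin n → ℝ)} {B a : ℝ}
    (hB : 0 < B) (hε : 0 ≤ ε Q) (hεB : ε Q ≤ B) (ha : 0 < a) (hQ0 : volume Q ≠ 0)
    (hQ : volume Q ≠ ∞) {f u v : (Fin n → ℝ) → ℝ} (hu : Measurable u)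
    (hfuv : ∀ y, |f y| ≤ u y + v y) :
    ENNReal.ofReal (epsAvg n ε f Q / (2 * B)) ^ a ≤
      (ENNReal.ofReal (ε Q / B) * ((volume Q)⁻¹ * ∫⁻ y in Q, ENNReal.ofReal (u y))) ^ a +
        ((volume Q)⁻¹ * ∫⁻ y in Q, ENNReal.ofReal (v y)) ^ a := by
  set U := (volume Q)⁻¹ * ∫⁻ y in Q, ENNReal.ofReal (u y) with hU
  set V := (volume Q)⁻¹ * ∫⁻ y in Q, ENNReal.ofReal (v y) with hV
  have h1 : (volume Q)⁻¹ * ∫⁻ y in Q, ENNReal.ofReal |f y| ≤ U + V := by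
    rw [hU, hV, ← mul_add, ← lintegral_add_left hu.ennreal_ofReal]
    gcongr with y
    exact (ENNReal.ofReal_le_ofReal (hfuv y)).trans ENNReal.ofReal_add_le
  have he1 : ENNReal.ofReal (ε Q / B) ≤ 1 := ENNReal.ofReal_le_one.2 ((div_le_one hB).2 hεB)
  have h2 : ENNReal.ofReal (epsAvg n ε f Q / (2 * B)) ≤ max (ENNReal.ofReal (ε Q / B) * U) V := by
    calc ENNReal.ofReal (epsAvg n ε f Q / (2 * B))
        = ENNReal.ofReal (1 / (2 * B)) * ENNReal.ofReal (epsAvg n ε f Q) := by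
          rw [← ENNReal.ofReal_mul (by positivity), one_div_mul_eq_div]
      _ ≤ ENNReal.ofReal (1 / (2 * B)) * (ENNReal.ofReal (ε Q) * (U + V)) := by
          gcongr
          exact (ofReal_epsAvg_le hε hQ0 hQ f).trans (by gcongr)
      _ = ENNReal.ofReal (1 / 2) *
            (ENNReal.ofReal (ε Q / B) * U + ENNReal.ofReal (ε Q / B) * V) := by
          have : ENNReal.ofReal (1 / (2 * B)) * ENNReal.ofReal (ε Q) =
              ENNReal.ofReal (1 / 2) * ENNReal.ofReal (ε Q / B) := by
            rw [← ENNReal.ofReal_mul (by positivity), ← ENNReal.ofReal_mul (by positivity)]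
            congr 1
            field_simp
          rw [← mul_assoc, this]
          ring
      _ ≤ ENNReal.ofReal (1 / 2) * (max (ENNReal.ofReal (ε Q / B) * U) V +
            max (ENNReal.ofReal (ε Q / B) * U) V) := by
          gcongr
          · exact le_max_left _ _
          · exact (mul_le_of_le_one_left' he1).trans (le_max_right _ _)
      _ = max (ENNReal.ofReal (ε Q / B) * U) V := by
          rw [← two_mul, ← mul_assoc]
          have : (2 : ℝ≥0∞) = ENNReal.ofReal 2 := by simp
          rw [this, ← ENNReal.ofReal_mul (by norm_num)]
          norm_num
  refine (ENNReal.rpow_le_rpow h2 ha.le).trans ?_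
  rcases le_total (ENNReal.ofReal (ε Q / B) * U) V with h | h
  · rw [max_eq_right h]
    exact le_add_self
  · rw [max_eq_left h]
    exact le_self_add

/-- The modular form of the boundedness of the `ε`-maximal operator. -/
theorem lintegral_epsMax_div_rpow_le {ε : Set (Fin n → ℝ) → ℝ} {B : ℝ} (hB : 1 ≤ B)
    (hεpos : ∀ Q, IsDyadicCube n Q → 0 < ε Q) (hεB : ∀ Q, IsDyadicCube n Q → ε Q ≤ B)
    {p : (Fin n → ℝ) → ℝ} (hp : Measurable p) {s : ℝ} (hs : 1 < s) (hsp : ∀ᵐ x, s ≤ p x)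
    {pinf Cinf : ℝ} (hpinf : 1 < pinf)
    (hLH : ∀ᵐ x : Fin n → ℝ, |p x - pinf| ≤ Cinf / Real.log (Real.exp 1 + ‖x‖))
    {pm pM : Set (Fin n → ℝ) → ℝ} (hspm : ∀ Q, IsDyadicCube n Q → s ≤ pm Q)
    (hpm : ∀ Q, IsDyadicCube n Q → ∀ᵐ x ∂volume.restrict Q, pm Q ≤ p x)
    (hpM : ∀ Q, IsDyadicCube n Q → ∀ᵐ x ∂volume.restrict Q, p x ≤ pM Q) {C : ℝ}
    (hLH0 : ∀ Q, IsDyadicCube n Q → ((volume Q).toReal / ε Q) ^ (pm Q - pM Q) ≤ C) :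
    ∃ K : ℝ≥0∞, K ≠ ∞ ∧ ∀ f : (Fin n → ℝ) → ℝ, Measurable f →
      ∫⁻ x, ENNReal.ofReal (|f x| ^ p x) ≤ 1 →
        ∫⁻ x, ENNReal.ofReal ((|epsMax n ε f x| / (2 * B)) ^ p x) ≤ K := by
  have hs0 : 0 < s := by linarith
  have hB0 : 0 < B := by linarith
  obtain ⟨K₂, hK₂, hdyadic⟩ := lintegral_dyadicMax_rpow_le_of_le_one
    (hsp.mono fun x hx => hs.le.trans hx) hpinf hLH
  set M := ENNReal.ofReal (2 ^ s * (s / (s - 1)))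
  have hMfin : M ≠ ∞ := ENNReal.ofReal_ne_top
  have hDfin : ENNReal.ofReal (max 1 C) ^ s ≠ ∞ :=
    ENNReal.rpow_ne_top_of_nonneg hs0.le ENNReal.ofReal_ne_top
  refine ⟨ENNReal.ofReal (max 1 C) ^ s * M + K₂, by finiteness, fun f hf hint => ?_⟩
  have hset : MeasurableSet {y | 1 ≤ |f y|} := measurableSet_le measurable_const hf.abs
  set u : (Fin n → ℝ) → ℝ := {y | 1 ≤ |f y|}.indicator fun y => |f y| with hu
  set v : (Fin n → ℝ) → ℝ := {y | 1 ≤ |f y|}ᶜ.indicator fun y => |f y| with hv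
  have hum : Measurable u := hf.abs.indicator hset
  have hvm : Measurable v := hf.abs.indicator hset.compl
  have hu0 : ∀ y, 0 ≤ u y := fun y => indicator_nonneg (fun _ _ => abs_nonneg _) y
  have hv0 : ∀ y, 0 ≤ v y := fun y => indicator_nonneg (fun _ _ => abs_nonneg _) y
  have huf : ∀ y, u y ≤ |f y| := fun y => indicator_le_self' (fun _ _ => abs_nonneg _) y
  have hvf : ∀ y, v y ≤ |f y| := fun y => indicator_le_self' (fun _ _ => abs_nonneg _) y
  have hu1 : ∀ y, u y = 0 ∨ 1 ≤ u y := fun y => by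
    by_cases hy : y ∈ {y | 1 ≤ |f y|}
    · right
      rw [hu, indicator_of_mem hy]
      exact hy
    · left
      rw [hu, indicator_of_notMem hy]
  have hv1 : ∀ y, v y ≤ 1 := fun y => by
    by_cases hy : y ∈ {y | 1 ≤ |f y|}ᶜ
    · rw [hv, indicator_of_mem hy]
      have hy' : |f y| < 1 := by simpa using hy
      exact hy'.le
    · rw [hv, indicator_of_notMem hy]
      exact zero_le_one
  have hfuv : ∀ y, |f y| = u y + v y := fun y =>
    (congrFun (indicator_self_add_compl {y | 1 ≤ |f y|} fun y => |f y|) y).symm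
  have hint_of_le : ∀ g : (Fin n → ℝ) → ℝ, (∀ y, 0 ≤ g y) → (∀ y, g y ≤ |f y|) →
      ∫⁻ y, ENNReal.ofReal (g y ^ p y) ≤ 1 := fun g hg0 hgf => by
    refine le_trans (lintegral_mono_ae ?_) hint
    filter_upwards [hsp] with y hy
    exact ENNReal.ofReal_le_ofReal (Real.rpow_le_rpow (hg0 y) (hgf y) (by linarith))
  have hv_int : ∫⁻ y, ENNReal.ofReal (v y) ^ p y ≤ 1 := by
    refine le_trans (lintegral_mono_ae ?_) (hint_of_le v hv0 hvf)
    filter_upwards [hsp] with y hy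
    rw [ENNReal.ofReal_rpow_of_nonneg (hv0 y) (by linarith)]
  set w : (Fin n → ℝ) → ℝ := fun y => u y ^ (p y / s) with hw
  have hw0 : ∀ y, 0 ≤ w y := fun y => Real.rpow_nonneg (hu0 y) _
  have hwm : Measurable w := hum.pow (hp.div_const s)
  have hw_int : ∫⁻ y, ENNReal.ofReal (w y) ^ s ≤ 1 := by
    refine le_trans (le_of_eq (lintegral_congr fun y => ?_)) (hint_of_le u hu0 huf)
    rw [ENNReal.ofReal_rpow_of_nonneg (hw0 y) hs0.le, hw, ← Real.rpow_mul (hu0 y),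
      div_mul_cancel₀ _ hs0.ne']
  have hcube : ∀ᵐ x, ∀ (k : ℤ) (m : Fin n → ℤ), x ∈ dyadicCube n k m →
      pm (dyadicCube n k m) ≤ p x ∧ p x ≤ pM (dyadicCube n k m) := by
    refine ae_all_iff.2 fun k => ae_all_iff.2 fun m => ?_
    have hQm : MeasurableSet (dyadicCube n k m) := by
      rw [dyadicCube_eq_preimage]
      exact measurable_dyadicIndex k (measurableSet_singleton m)
    exact (ae_restrict_iff' hQm).1 ((hpm _ ⟨k, m, rfl⟩).and (hpM _ ⟨k, m, rfl⟩))
  have hpoint : ∀ᵐ x, ENNReal.ofReal ((|epsMax n ε f x| / (2 * B)) ^ p x) ≤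
      ENNReal.ofReal (max 1 C) ^ s * dyadicMax n w x ^ s + dyadicMax n v x ^ p x := by
    filter_upwards [hcube, hsp] with x hx hsx
    have hpx : 0 < p x := by linarith
    refine ofReal_abs_sSup_div_rpow_le ?_ (by positivity) hpx ?_
    · rintro r ⟨Q, hQ, -, rfl⟩
      have := hεpos Q hQ
      unfold epsAvg
      positivity
    · rintro r ⟨Q, ⟨k, m, rfl⟩, hxQ, rfl⟩
      have hQ : IsDyadicCube n (dyadicCube n k m) := ⟨k, m, rfl⟩
      have hε := hεpos _ hQ
      refine (ofReal_epsAvg_div_rpow_le hB0 hε.le (hεB _ hQ) hpx (volume_dyadicCube_ne_zero k m)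
        (volume_dyadicCube_ne_top k m) hum fun y => (hfuv y).le).trans ?_
      gcongr ?_ + ?_ ^ p x
      · refine (weighted_setAverage_rpow_le (volume_dyadicCube_ne_zero k m)
          (volume_dyadicCube_ne_top k m) hum hu1 hs.le (hspm _ hQ) (hpm _ hQ) (hx k m hxQ).1
          (hx k m hxQ).2 (div_pos hε hB0) ((div_le_one hB0).2 (hεB _ hQ))
          (div_le_self hε.le hB) (hLH0 _ hQ) (hint_of_le u hu0 huf)).trans ?_
        gcongr
        exact setAverage_le_dyadicMax hxQ w
      · exact setAverage_le_dyadicMax hxQ v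
  calc ∫⁻ x, ENNReal.ofReal ((|epsMax n ε f x| / (2 * B)) ^ p x)
      ≤ ∫⁻ x, (ENNReal.ofReal (max 1 C) ^ s * dyadicMax n w x ^ s + dyadicMax n v x ^ p x) :=
        lintegral_mono_ae hpoint
    _ = ENNReal.ofReal (max 1 C) ^ s * (∫⁻ x, dyadicMax n w x ^ s) +
          ∫⁻ x, dyadicMax n v x ^ p x := by
        rw [lintegral_add_left (((measurable_dyadicMax w).pow_const s).const_mul _),
          lintegral_const_mul' _ _ hDfin]
    _ ≤ ENNReal.ofReal (max 1 C) ^ s * M + K₂ := by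
        gcongr
        · exact (lintegral_dyadicMax_rpow_le hw0 hwm hs).trans (mul_le_of_le_one_right' hw_int)
        · exact hdyadic v hvm hv0 hv1 hv_int

end Modular

open scoped Pointwise in
theorem epsMax_div {n : ℕ} (ε : Set (Fin n → ℝ) → ℝ) (f : (Fin n → ℝ) → ℝ) {r : ℝ} (hr : 0 < r)
    (x : Fin n → ℝ) : epsMax n ε (fun y => f y / r) x = epsMax n ε f x / r := by
  have h : ∀ Q, epsAvg n ε (fun y => f y / r) Q = r⁻¹ * epsAvg n ε f Q := fun Q => by
    simp only [epsAvg, abs_div, abs_of_pos hr, integral_div]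
    ring
  have hset : {t : ℝ | ∃ Q, IsDyadicCube n Q ∧ x ∈ Q ∧ t = epsAvg n ε (fun y => f y / r) Q} =
      r⁻¹ • {t : ℝ | ∃ Q, IsDyadicCube n Q ∧ x ∈ Q ∧ t = epsAvg n ε f Q} := by
    ext t
    simp only [h, Set.mem_smul_set, Set.mem_ofPred_eq, smul_eq_mul]
    constructor
    · rintro ⟨Q, hQ, hx, rfl⟩
      exact ⟨_, ⟨Q, hQ, hx, rfl⟩, rfl⟩
    · rintro ⟨_, ⟨Q, hQ, hx, rfl⟩, rfl⟩
      exact ⟨Q, hQ, hx, rfl⟩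
  rw [epsMax, hset, Real.sSup_smul_of_nonneg (by positivity), smul_eq_mul, epsMax, inv_mul_eq_div]

/-- **Theorem 1.1 (boundedness of the ε-maximal operator).**
If `ε = {ε_Q}` is a bounded collection of positive numbers with the domination
property and `p ∈ LH_∞(ℝⁿ) ∩ εLH_0(ℝⁿ)` with `1 < p_- ≤ p_+ < ∞`, then `M_ε`
is bounded on `L^{p(·)}(ℝⁿ)`. -/
theorem epsMax_bounded (n : ℕ) (ε : Set (Fin n → ℝ) → ℝ)
    (hεpos : ∀ Q, IsDyadicCube n Q → 0 < ε Q)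
    (hεbdd : ∃ B : ℝ, ∀ Q, IsDyadicCube n Q → ε Q ≤ B)
    (hεdom : ∀ P Q, IsDyadicCube n P → IsDyadicCube n Q → P ⊆ Q → ε P ≤ ε Q)
    (p : (Fin n → ℝ) → ℝ) (hpMeas : Measurable p) (hp1 : ∀ x, 1 ≤ p x)
    (hpminus : 1 < essInf p volume)
    (hpplus : ∃ B : ℝ, ∀ᵐ x ∂volume, p x ≤ B)
    (hLHinf : ∃ Cinf : ℝ, 0 < Cinf ∧ ∃ pinf : ℝ, ∀ x : Fin n → ℝ,
      |p x - pinf| ≤ Cinf / Real.log (Real.exp 1 + ‖x‖))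
    (hLH0 : ∃ C0 : ℝ, 0 < C0 ∧ ∀ Q, IsDyadicCube n Q →
      ((volume Q).toReal / ε Q) ^
        (essInf p (volume.restrict Q) - essSup p (volume.restrict Q)) ≤ C0) :
    ∃ C : ℝ, 0 < C ∧ ∀ f : (Fin n → ℝ) → ℝ, Measurable f → MemVarLp p volume f →
      varLpNorm p volume (epsMax n ε f) ≤ ENNReal.ofReal C * varLpNorm p volume f := by
  obtain ⟨B, hB⟩ := hεbdd
  obtain ⟨P, hP⟩ := hpplus
  obtain ⟨Cinf, -, pinf, hLH⟩ := hLHinf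
  obtain ⟨C0, -, hC0⟩ := hLH0
  have hbddge : ∀ μ : Measure (Fin n → ℝ), Filter.IsBoundedUnder (· ≥ ·) (ae μ) p := fun μ =>
    Filter.isBoundedUnder_of ⟨1, hp1⟩
  have hne : ∀ Q, IsDyadicCube n Q → (ae (volume.restrict Q)).NeBot := by
    rintro _ ⟨k, m, rfl⟩
    rw [ae_neBot, Ne, Measure.restrict_eq_zero]
    exact volume_dyadicCube_ne_zero k m
  have hbddle : ∀ Q, Filter.IsBoundedUnder (· ≤ ·) (ae (volume.restrict Q)) p := fun Q =>
    ⟨P, Filter.eventually_map.2 (ae_restrict_of_ae hP)⟩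
  have hsp : ∀ᵐ x, essInf p volume ≤ p x := ae_essInf_le (hbddge _)
  obtain ⟨K, hK, hmod⟩ := lintegral_epsMax_div_rpow_le (le_max_right B 1) hεpos
    (fun Q hQ => (hB Q hQ).trans (le_max_left _ _)) hpMeas hpminus hsp
    (hpminus.trans_le (le_max_right pinf (essInf p volume))) (Cinf := Cinf)
    (by
      filter_upwards [hsp] with x hx
      refine le_trans ?_ (hLH x)
      calc |p x - max pinf (essInf p volume)|
          = |max (p x) (essInf p volume) - max pinf (essInf p volume)| := by rw [max_eq_left hx]
        _ ≤ |p x - pinf| := abs_max_sub_max_le_abs _ _ _)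
    (pm := fun Q => essInf p (volume.restrict Q)) (pM := fun Q => essSup p (volume.restrict Q))
    (fun Q hQ => by
      have := hne Q hQ
      exact le_essInf_of_ae_le _ (ae_restrict_of_ae hsp) (hbddle Q).isCoboundedUnder_ge)
    (fun Q _ => ae_essInf_le (hbddge _)) (fun Q _ => ae_le_essSup (hbddle Q)) hC0
  set L := max 1 K.toReal
  have hL1 : 1 ≤ L := le_max_left _ _
  have hKL : K ≤ ENNReal.ofReal L := by
    rw [← ENNReal.ofReal_toReal hK]
    exact ENNReal.ofReal_le_ofReal (le_max_right _ _)
  have hB1 : 0 < max B 1 := lt_max_of_lt_right one_pos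
  have hD : 0 < L * (2 * max B 1) := by positivity
  refine ⟨L * (2 * max B 1), hD, fun f hf _ => ?_⟩
  have key : ∀ r : ℝ, 0 < r → ∫⁻ x, ENNReal.ofReal ((|f x| / r) ^ p x) ≤ 1 →
      varLpNorm p volume (epsMax n ε f) ≤
        ENNReal.ofReal (L * (2 * max B 1)) * ENNReal.ofReal r := by
    intro r hr hint
    refine sInf_le ⟨L * (2 * max B 1) * r, by positivity, (ENNReal.ofReal_mul hD.le).symm, ?_⟩
    have h := hmod (fun x => f x / r) (hf.div_const r) (by
      simpa only [abs_div, abs_of_pos hr] using hint)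
    calc ∫⁻ x, ENNReal.ofReal ((|epsMax n ε f x| / (L * (2 * max B 1) * r)) ^ p x)
        ≤ ∫⁻ x, ENNReal.ofReal L⁻¹ *
            ENNReal.ofReal ((|epsMax n ε (fun y => f y / r) x| / (2 * max B 1)) ^ p x) := by
          refine lintegral_mono fun x => ?_
          rw [← ENNReal.ofReal_mul (by positivity), epsMax_div ε f hr, abs_div, abs_of_pos hr]
          refine ENNReal.ofReal_le_ofReal ?_
          have : |epsMax n ε f x| / (L * (2 * max B 1) * r) =
              L⁻¹ * (|epsMax n ε f x| / r / (2 * max B 1)) := by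
            field_simp
          rw [this, Real.mul_rpow (by positivity) (by positivity)]
          gcongr
          simpa using Real.rpow_le_rpow_of_exponent_ge (by positivity) (inv_le_one_of_one_le₀ hL1)
            (hp1 x)
      _ = ENNReal.ofReal L⁻¹ *
            ∫⁻ x, ENNReal.ofReal ((|epsMax n ε (fun y => f y / r) x| / (2 * max B 1)) ^ p x) :=
          lintegral_const_mul' _ _ ENNReal.ofReal_ne_top
      _ ≤ ENNReal.ofReal L⁻¹ * ENNReal.ofReal L := by
          gcongr
          exact h.trans hKL
      _ = 1 := by
          rw [← ENNReal.ofReal_mul (by positivity), inv_mul_cancel₀ (by positivity),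
            ENNReal.ofReal_one]
  conv_rhs => rw [varLpNorm, sInf_eq_iInf]
  have hD' : ENNReal.ofReal (L * (2 * max B 1)) ≠ 0 := (ENNReal.ofReal_pos.2 hD).ne'
  simp_rw [ENNReal.mul_iInf_of_ne hD' ENNReal.ofReal_ne_top]
  refine le_iInf₂ ?_
  rintro _ ⟨r, hr, rfl, hint⟩
  exact key r hr hint
end
end

section
/- Let p be an exponent function on ℝⁿ with 1 < p_- ≤ p_+ < ∞ and let p' be its conjugate exponent function, defined pointwise by 1/p'(x) = 1 − 1/p(x). Then for every measurable set Q ⊆ ℝⁿ of positive measure, (p')_+(Q) − (p')_-(Q) ≥ (((p')_-)²/(p_+)²)·(p_+(Q) − p_-(Q)), where (p')_- denotes the essential infimum of p' on ℝⁿ. -/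
open MeasureTheory Set ENNReal

noncomputable section

open Filter

section Conjugate

variable {s t : ℝ}

lemma conj_eq_one_add (ht : 1 < t) : (1 - t⁻¹)⁻¹ = 1 + (t - 1)⁻¹ := by
  have h0 : t ≠ 0 := by positivity
  have h1 : t - 1 ≠ 0 := by linarith
  have h2 : 1 - t⁻¹ = (t - 1) / t := by field_simp
  rw [h2]
  field_simp
  ring

lemma one_lt_conj (ht : 1 < t) : 1 < (1 - t⁻¹)⁻¹ := by
  rw [conj_eq_one_add ht]
  have : 0 < (t - 1)⁻¹ := inv_pos.2 (by linarith)
  linarith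

lemma conj_le_conj (hs : 1 < s) (hst : s ≤ t) : (1 - t⁻¹)⁻¹ ≤ (1 - s⁻¹)⁻¹ := by
  rw [conj_eq_one_add hs, conj_eq_one_add (hs.trans_le hst)]
  have : (t - 1)⁻¹ ≤ (s - 1)⁻¹ := inv_anti₀ (by linarith) (by linarith)
  linarith

end Conjugate

section EssBounds

variable {α : Type*} [MeasurableSpace α] {μ : Measure α} {f : α → ℝ} {m M : ℝ}

lemma isBoundedUnder_le_conj (hm : 1 < m) (hmf : ∀ᵐ x ∂μ, m ≤ f x) :
    IsBoundedUnder (· ≤ ·) (ae μ) fun x => (1 - (f x)⁻¹)⁻¹ :=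
  isBoundedUnder_of_eventually_le (hmf.mono fun _ hx => conj_le_conj hm hx)

lemma isBoundedUnder_ge_conj (hm : 1 < m) (hmf : ∀ᵐ x ∂μ, m ≤ f x) :
    IsBoundedUnder (· ≥ ·) (ae μ) fun x => (1 - (f x)⁻¹)⁻¹ :=
  isBoundedUnder_of_eventually_ge
    (hmf.mono fun _ hx => (one_lt_conj (hm.trans_le hx)).le)

lemma le_essInf_of_ae_bounds [(ae μ).NeBot] {c : ℝ} (hcf : ∀ᵐ x ∂μ, c ≤ f x)
    (hfM : ∀ᵐ x ∂μ, f x ≤ M) : c ≤ essInf f μ :=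
  le_liminf_of_le (isBoundedUnder_of_eventually_le hfM).isCoboundedUnder_ge hcf

lemma essSup_le_of_ae_bounds [(ae μ).NeBot] {c : ℝ} (hmf : ∀ᵐ x ∂μ, m ≤ f x)
    (hfc : ∀ᵐ x ∂μ, f x ≤ c) : essSup f μ ≤ c :=
  limsup_le_of_le (isBoundedUnder_of_eventually_ge hmf).isCoboundedUnder_le hfc

lemma essInf_le_essSup_of_ae_bounds [(ae μ).NeBot] (hmf : ∀ᵐ x ∂μ, m ≤ f x)
    (hfM : ∀ᵐ x ∂μ, f x ≤ M) : essInf f μ ≤ essSup f μ :=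
  liminf_le_limsup (isBoundedUnder_of_eventually_le hfM) (isBoundedUnder_of_eventually_ge hmf)

lemma conj_essInf_le_essSup_conj [(ae μ).NeBot] (hm : 1 < m) (hmf : ∀ᵐ x ∂μ, m ≤ f x)
    (hfM : ∀ᵐ x ∂μ, f x ≤ M) :
    (1 - (essInf f μ)⁻¹)⁻¹ ≤ essSup (fun x => (1 - (f x)⁻¹)⁻¹) μ := by
  have hS := ae_le_essSup (isBoundedUnder_le_conj hm hmf)
  set S := essSup (fun x => (1 - (f x)⁻¹)⁻¹) μ
  obtain ⟨y, hy, hyS⟩ := (hmf.and hS).exists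
  have hS1 : 1 < S := (one_lt_conj (hm.trans_le hy)).trans_le hyS
  have hle : (1 - S⁻¹)⁻¹ ≤ essInf f μ := by
    refine le_essInf_of_ae_bounds ?_ hfM
    filter_upwards [hmf, hS] with x hx hxS
    simpa using conj_le_conj (one_lt_conj (hm.trans_le hx)) hxS
  simpa using conj_le_conj (one_lt_conj hS1) hle

lemma essInf_conj_le_conj_essSup [(ae μ).NeBot] (hm : 1 < m) (hmf : ∀ᵐ x ∂μ, m ≤ f x)
    (hfM : ∀ᵐ x ∂μ, f x ≤ M) :
    essInf (fun x => (1 - (f x)⁻¹)⁻¹) μ ≤ (1 - (essSup f μ)⁻¹)⁻¹ := by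
  have hI := ae_essInf_le (isBoundedUnder_ge_conj hm hmf)
  set I := essInf (fun x => (1 - (f x)⁻¹)⁻¹) μ
  have hb : 1 < essSup f μ := hm.trans_le
    ((le_essInf_of_ae_bounds hmf hfM).trans (essInf_le_essSup_of_ae_bounds hmf hfM))
  rcases le_or_gt I 1 with h1 | h1
  · exact h1.trans (one_lt_conj hb).le
  · have hle : essSup f μ ≤ (1 - I⁻¹)⁻¹ := by
      refine essSup_le_of_ae_bounds hmf ?_
      filter_upwards [hI] with x hxI
      simpa using conj_le_conj h1 hxI
    simpa using conj_le_conj hb hle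

end EssBounds

lemma conj_sub_conj_ge {a b c : ℝ} (ha : 1 < a) (hab : a ≤ b) (hbc : b ≤ c) :
    ((1 - c⁻¹)⁻¹) ^ 2 / c ^ 2 * (b - a) ≤ (1 - a⁻¹)⁻¹ - (1 - b⁻¹)⁻¹ := by
  have ha' : 0 < a - 1 := by linarith
  have hb' : 0 < b - 1 := by linarith
  have hc' : 0 < c - 1 := by linarith
  have hc0 : 0 < c := by linarith
  have hl : ((1 - c⁻¹)⁻¹) ^ 2 / c ^ 2 = 1 / ((c - 1) * (c - 1)) := by
    rw [conj_eq_one_add (by linarith)]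
    field_simp
    ring
  have hr : (1 - a⁻¹)⁻¹ - (1 - b⁻¹)⁻¹ = 1 / ((a - 1) * (b - 1)) * (b - a) := by
    rw [conj_eq_one_add ha, conj_eq_one_add (by linarith)]
    field_simp
    ring
  rw [hl, hr]
  gcongr
  linarith

/-- **Inequality (2.1) in Lemma 2.14.** Let `p` be an exponent function on `ℝⁿ` with
`1 < p_- ≤ p_+ < ∞`, and let `p'` be its conjugate exponent function, defined
pointwise by `1/p'(x) = 1 - 1/p(x)`. Then for every measurable set `Q ⊆ ℝⁿ` of
positive measure,
`(p')_+(Q) - (p')_-(Q) ≥ (((p')_-)² / (p_+)²) (p_+(Q) - p_-(Q))`. -/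
theorem conj_exponent_oscillation (n : ℕ) (p : (Fin n → ℝ) → ℝ)
    (hpMeas : Measurable p) (hp1 : ∀ x, 1 ≤ p x)
    (hpminus : 1 < essInf p volume)
    (hpplus : ∃ B : ℝ, ∀ᵐ x ∂volume, p x ≤ B)
    (Q : Set (Fin n → ℝ)) (hQ : MeasurableSet Q) (hQpos : volume Q ≠ 0) :
    essSup (fun x => (1 - (p x)⁻¹)⁻¹) (volume.restrict Q) -
        essInf (fun x => (1 - (p x)⁻¹)⁻¹) (volume.restrict Q) ≥
      ((essInf (fun x => (1 - (p x)⁻¹)⁻¹) volume) ^ 2 / (essSup p volume) ^ 2) *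
        (essSup p (volume.restrict Q) - essInf p (volume.restrict Q)) := by
  obtain ⟨B, hB⟩ := hpplus
  have hQne : (ae (volume.restrict Q)).NeBot :=
    ae_neBot.2 (mt Measure.restrict_eq_zero.1 hQpos)
  have hne : (ae (volume : Measure (Fin n → ℝ))).NeBot :=
    hQne.mono (ae_mono Measure.restrict_le_self)
  have hm : ∀ᵐ x, essInf p volume ≤ p x :=
    ae_essInf_le (isBoundedUnder_of_eventually_ge (.of_forall hp1))
  have hM : ∀ᵐ x, p x ≤ essSup p volume :=
    ae_le_essSup (isBoundedUnder_of_eventually_le hB)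
  have hmQ := ae_restrict_of_ae (s := Q) hm
  have hMQ := ae_restrict_of_ae (s := Q) hM
  have ha : 1 < essInf p (volume.restrict Q) :=
    hpminus.trans_le (le_essInf_of_ae_bounds hmQ hMQ)
  have hab := essInf_le_essSup_of_ae_bounds hmQ hMQ
  have hbc := essSup_le_of_ae_bounds hmQ hMQ
  have hI0 : 0 ≤ essInf (fun x => (1 - (p x)⁻¹)⁻¹) volume :=
    le_essInf_of_ae_bounds
      (hm.mono fun x hx => zero_le_one.trans (one_lt_conj (hpminus.trans_le hx)).le)
      (hm.mono fun x hx => conj_le_conj hpminus hx)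
  calc _ ≤ ((1 - (essSup p volume)⁻¹)⁻¹) ^ 2 / (essSup p volume) ^ 2 *
        (essSup p (volume.restrict Q) - essInf p (volume.restrict Q)) := by
        have := sub_nonneg.2 hab
        gcongr
        exact essInf_conj_le_conj_essSup hpminus hm hM
    _ ≤ _ := conj_sub_conj_ge ha hab hbc
    _ ≤ _ := sub_le_sub (conj_essInf_le_essSup_conj hpminus hmQ hMQ)
        (essInf_conj_le_conj_essSup hpminus hmQ hMQ)
end
end
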